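/- arXiv:2407.04310 — 7 statements merged into one kernel-verified Lean document; each statement's English description precedes it below -/
import Mathlib

section
/- Let n ≥ 1, let x, y be real symmetric n×n matrices with y positive definite, and let α, γ > 0. Then the (2n²+2n)×(2n²+2n) block-diagonal matrix g = blockdiag(α·(y⁻¹ ⊗ y⁻¹), α·(y⁻¹ ⊗ y⁻¹), G), where ⊗ denotes the Kronecker product and G is the 2n×2n block matrix G = [[γ·y⁻¹, γ·y⁻¹x], [γ·x y⁻¹, γ·(y + x y⁻¹ x)]], is invertible with inverse blockdiag(α⁻¹·(y ⊗ y), α⁻¹·(y ⊗ y), G') where G' = [[γ⁻¹·(y + x y⁻¹ x), −γ⁻¹·x y⁻¹], [−γ⁻¹·y⁻¹ x, γ⁻¹·y⁻¹]]. -/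
open Matrix Kronecker

/-- The inverse of the metric matrix of the balanced metric on the Siegel–Jacobi
upper half space `𝒳ⁿᴶ` in coordinates `(x, y, q, p)`. -/
theorem inverse_metric_siegel_jacobi_space
    (n : ℕ) (hn : 1 ≤ n) (x y : Matrix (Fin n) (Fin n) ℝ)
    (hx : x.IsSymm) (hy : y.IsSymm) (hypd : y.PosDef)
    (α γ : ℝ) (hα : 0 < α) (hγ : 0 < γ) :
    let G : Matrix (Fin n ⊕ Fin n) (Fin n ⊕ Fin n) ℝ :=
      Matrix.fromBlocks (γ • y⁻¹) (γ • (y⁻¹ * x))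
        (γ • (x * y⁻¹)) (γ • (y + x * y⁻¹ * x))
    let G' : Matrix (Fin n ⊕ Fin n) (Fin n ⊕ Fin n) ℝ :=
      Matrix.fromBlocks (γ⁻¹ • (y + x * y⁻¹ * x)) (-(γ⁻¹ • (x * y⁻¹)))
        (-(γ⁻¹ • (y⁻¹ * x))) (γ⁻¹ • y⁻¹)
    let g : Matrix ((Fin n × Fin n) ⊕ ((Fin n × Fin n) ⊕ (Fin n ⊕ Fin n)))
        ((Fin n × Fin n) ⊕ ((Fin n × Fin n) ⊕ (Fin n ⊕ Fin n))) ℝ :=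
      Matrix.fromBlocks (α • (y⁻¹ ⊗ₖ y⁻¹)) 0 0
        (Matrix.fromBlocks (α • (y⁻¹ ⊗ₖ y⁻¹)) 0 0 G)
    let g' : Matrix ((Fin n × Fin n) ⊕ ((Fin n × Fin n) ⊕ (Fin n ⊕ Fin n)))
        ((Fin n × Fin n) ⊕ ((Fin n × Fin n) ⊕ (Fin n ⊕ Fin n))) ℝ :=
      Matrix.fromBlocks (α⁻¹ • (y ⊗ₖ y)) 0 0
        (Matrix.fromBlocks (α⁻¹ • (y ⊗ₖ y)) 0 0 G')
    g * g' = 1 ∧ g' * g = 1 := by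
  intro G G' g g'
  have hdet : IsUnit y.det := hypd.det_pos.ne'.isUnit
  have h1 : y * y⁻¹ = 1 := Matrix.mul_nonsing_inv y hdet
  have h2 : y⁻¹ * y = 1 := Matrix.nonsing_inv_mul y hdet
  have hG : G * G' = 1 := by
    simp only [G, G']
    generalize y⁻¹ = z at *
    have h3 : ∀ w : Matrix (Fin n) (Fin n) ℝ, z * (y * w) = w := fun w => by
      rw [← Matrix.mul_assoc, h2, Matrix.one_mul]
    have h4 : ∀ w : Matrix (Fin n) (Fin n) ℝ, y * (z * w) = w := fun w => by
      rw [← Matrix.mul_assoc, h1, Matrix.one_mul]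
    rw [Matrix.fromBlocks_multiply, ← Matrix.fromBlocks_one]
    congr 1 <;>
    simp [Matrix.mul_add, Matrix.add_mul, Matrix.mul_assoc, h1, h2, h3, h4, smul_smul, hγ.ne']
  have hK : (α • (y⁻¹ ⊗ₖ y⁻¹)) * (α⁻¹ • (y ⊗ₖ y)) = 1 := by
    rw [Matrix.smul_mul, Matrix.mul_smul, smul_smul, mul_inv_cancel₀ hα.ne', one_smul,
      ← Matrix.mul_kronecker_mul, h2, Matrix.one_kronecker_one]
  have hg : g * g' = 1 := by
    simp only [g, g', Matrix.fromBlocks_multiply, hK, hG, Matrix.mul_zero, Matrix.zero_mul,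
      add_zero, zero_add, Matrix.fromBlocks_one]
  exact ⟨hg, mul_eq_one_comm.mp hg⟩
end

section
/- Let n ≥ 1, let x, y be real symmetric n×n matrices with y positive definite, let p, q be real 1×n row vectors, and let γ, δ > 0. Assume that the n×n matrices γ·1 + δ·pᵗp y, γ·1 + δ·y pᵗp, and 1 + (δ/γ)·pᵗp y are invertible (here pᵗp and qᵗp etc. are n×n matrices of rank ≤ 1). Then γ·(y + x y⁻¹ x) + δ·qᵗq − (γ·x y⁻¹ − δ·pᵗq)(γ·y⁻¹ + δ·pᵗp)⁻¹(γ·y⁻¹ x − δ·qᵗp) = γ·y + δ·qᵗq + δ·x pᵗp y (1 + (δ/γ)·pᵗp y)⁻¹ y⁻¹ x + γδ·x (γ·1 + δ·pᵗp y)⁻¹ qᵗp + γδ·pᵗq (γ·1 + δ·y pᵗp)⁻¹ x − δ²·pᵗq y (γ·1 + δ·pᵗp y)⁻¹ qᵗp. -/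
open Matrix

/-- The simplified expression for the inverse of the block `a₂₂` of the inverse
of the `(q,p)`-block `A₁₁` of the metric matrix of the invariant metric on the
extended Siegel–Jacobi upper half space. -/
theorem a22_inverse_simplified
    (n : ℕ) (hn : 1 ≤ n) (x y : Matrix (Fin n) (Fin n) ℝ)
    (hx : x.IsSymm) (hy : y.IsSymm) (hypd : y.PosDef)
    (p q : Matrix (Fin 1) (Fin n) ℝ) (γ δ : ℝ) (hγ : 0 < γ) (hδ : 0 < δ)
    (h1 : IsUnit (γ • (1 : Matrix (Fin n) (Fin n) ℝ) + δ • (pᵀ * p * y)))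
    (h2 : IsUnit (γ • (1 : Matrix (Fin n) (Fin n) ℝ) + δ • (y * (pᵀ * p))))
    (h3 : IsUnit ((1 : Matrix (Fin n) (Fin n) ℝ) + (δ / γ) • (pᵀ * p * y))) :
    γ • (y + x * y⁻¹ * x) + δ • (qᵀ * q) -
        (γ • (x * y⁻¹) - δ • (pᵀ * q)) * (γ • y⁻¹ + δ • (pᵀ * p))⁻¹ *
          (γ • (y⁻¹ * x) - δ • (qᵀ * p)) =
      γ • y + δ • (qᵀ * q) +
        δ • (x * (pᵀ * p) * y *
          ((1 : Matrix (Fin n) (Fin n) ℝ) + (δ / γ) • (pᵀ * p * y))⁻¹ * (y⁻¹ * x)) +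
        (γ * δ) • (x * (γ • (1 : Matrix (Fin n) (Fin n) ℝ) + δ • (pᵀ * p * y))⁻¹ * (qᵀ * p)) +
        (γ * δ) • ((pᵀ * q) * (γ • (1 : Matrix (Fin n) (Fin n) ℝ) + δ • (y * (pᵀ * p)))⁻¹ * x) -
        (δ ^ 2) • ((pᵀ * q) * y *
          (γ • (1 : Matrix (Fin n) (Fin n) ℝ) + δ • (pᵀ * p * y))⁻¹ * (qᵀ * p)) := by
  have hyu : IsUnit y.det := (Matrix.isUnit_iff_isUnit_det y).1 hypd.isUnit
  have hyY : y * y⁻¹ = 1 := Matrix.mul_nonsing_inv y hyu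
  have hYy : y⁻¹ * y = 1 := Matrix.nonsing_inv_mul y hyu
  have hA := Matrix.mul_nonsing_inv _ ((Matrix.isUnit_iff_isUnit_det _).1 h1)
  have hγ0 : γ ≠ 0 := hγ.ne'
  generalize hPd : pᵀ * p = P at *
  generalize hUd : pᵀ * q = U at *
  generalize hVd : qᵀ * p = V at *
  generalize hQd : qᵀ * q = Q at *
  generalize had : (γ • (1 : Matrix (Fin n) (Fin n) ℝ) + δ • (P * y))⁻¹ = a at *
  generalize hYd : y⁻¹ = Y at *
  have e3 : ((1 : Matrix (Fin n) (Fin n) ℝ) + (δ / γ) • (P * y))⁻¹ = γ • a := by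
    apply Matrix.inv_eq_right_inv
    rw [mul_smul_comm, ← smul_mul_assoc, smul_add, smul_smul, mul_div_cancel₀ _ hγ0, hA]
  have eM : (γ • Y + δ • P)⁻¹ = y * a := by
    apply Matrix.inv_eq_right_inv
    rw [← mul_assoc, add_mul, smul_mul_assoc, smul_mul_assoc, hYy, hA]
  have eB : (γ • (1 : Matrix (Fin n) (Fin n) ℝ) + δ • (y * P))⁻¹ = y * a * Y := by
    apply Matrix.inv_eq_right_inv
    have : (γ • (1 : Matrix (Fin n) (Fin n) ℝ) + δ • (y * P)) * y
        = y * (γ • (1 : Matrix (Fin n) (Fin n) ℝ) + δ • (P * y)) := by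
      simp [add_mul, mul_add, mul_assoc]
    rw [← mul_assoc, ← mul_assoc, this, mul_assoc y, hA, mul_one, hyY]
  rw [e3, eM, eB]
  have hYy' : ∀ z, Y * (y * z) = z := fun z => by rw [← mul_assoc, hYy, one_mul]
  have key : γ • (x * (Y * x)) = (γ * γ) • (x * (a * (Y * x)))
      + (γ * δ) • (x * (P * (y * (a * (Y * x))))) := by
    have h := congrArg (fun z => γ • (x * (z * (Y * x)))) hA
    simp only [add_mul, mul_add, smul_mul_assoc, mul_smul_comm, one_mul, mul_assoc, smul_add,
      smul_smul] at h
    exact h.symm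
  simp only [add_mul, mul_add, sub_mul, mul_sub, smul_mul_assoc, mul_smul_comm, mul_assoc,
    smul_add, smul_sub, smul_smul, hYy', key]
  module
end

section
/- Let x, y, p, q ∈ ℝ with y > 0 and γ, δ > 0. Let g be the symmetric 5×5 matrix (with row/column order x, y, q, p, κ) whose nonzero entries are g₁₁ = g₂₂ = α/y², g₃₃ = γ/y + δp², g₄₄ = γ(x² + y²)/y + δq², g₃₄ = g₄₃ = γx/y − δpq, g₃₅ = g₅₃ = −δp, g₄₅ = g₅₄ = δq, g₅₅ = δ, where α > 0. Then g is invertible and the (3,4) entry (the (q,p) entry) of g⁻¹ equals −x/(γ y). -/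
open Matrix

/-- The `(q,p)` entry of the inverse of the metric matrix of the
`G^J_1(ℝ)`-invariant metric on the extended Siegel–Jacobi upper half plane
`𝒳̃₁ᴶ` (coordinate order `x, y, q, p, κ`) equals `−x/(γy)`. -/
theorem inverse_metric_qp_entry_extended_plane
    (x y p q α γ δ : ℝ) (hy : 0 < y) (hα : 0 < α) (hγ : 0 < γ) (hδ : 0 < δ) :
    let g : Matrix (Fin 5) (Fin 5) ℝ :=
      !![α / y ^ 2, 0, 0, 0, 0;
         0, α / y ^ 2, 0, 0, 0;
         0, 0, γ / y + δ * p ^ 2, γ * x / y - δ * p * q, -(δ * p);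
         0, 0, γ * x / y - δ * p * q, γ * (x ^ 2 + y ^ 2) / y + δ * q ^ 2, δ * q;
         0, 0, -(δ * p), δ * q, δ]
    IsUnit g ∧ g⁻¹ 2 3 = -(x / (γ * y)) := by
  intro g
  have hy' : y ≠ 0 := hy.ne'
  have hα' : α ≠ 0 := hα.ne'
  have hγ' : γ ≠ 0 := hγ.ne'
  have hδ' : δ ≠ 0 := hδ.ne'
  let h : Matrix (Fin 5) (Fin 5) ℝ :=
      !![y ^ 2 / α, 0, 0, 0, 0;
         0, y ^ 2 / α, 0, 0, 0;
         0, 0, (x ^ 2 + y ^ 2) / (γ * y), -(x / (γ * y)),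
           (p * (x ^ 2 + y ^ 2) + x * q) / (γ * y);
         0, 0, -(x / (γ * y)), 1 / (γ * y), -((x * p + q) / (γ * y));
         0, 0, (p * (x ^ 2 + y ^ 2) + x * q) / (γ * y), -((x * p + q) / (γ * y)),
           1 / δ + (p ^ 2 * (x ^ 2 + y ^ 2) + 2 * x * p * q + q ^ 2) / (γ * y)]
  have hgh : g * h = 1 := by
    ext i j
    fin_cases i <;> fin_cases j <;>
      simp [g, h, Matrix.mul_apply, Fin.sum_univ_five, Matrix.one_apply] <;>
      field_simp <;> ring
  refine ⟨IsUnit.of_mul_eq_one h hgh, ?_⟩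
  rw [Matrix.inv_eq_right_inv hgh]
  simp [h]
end

section
/- Let α, γ, δ > 0. On the open set {(x, y, q, p, κ) ∈ ℝ⁵ : y > 0} with coordinates (u¹,…,u⁵) = (x, y, q, p, κ), let g be the symmetric 5×5 matrix field whose nonzero entries are g₁₁ = g₂₂ = α/y², g₃₃ = γ/y + δp², g₄₄ = γ(x² + y²)/y + δq², g₃₄ = g₄₃ = γx/y − δpq, g₃₅ = g₅₃ = −δp, g₄₅ = g₅₄ = δq, g₅₅ = δ, and define the Christoffel symbols of the second kind by Γᵏᵢⱼ = (1/2)·Σₗ gᵏˡ(∂ᵢ gⱼₗ + ∂ⱼ gᵢₗ − ∂ₗ gᵢⱼ), where (gᵏˡ) = g⁻¹. Then at every point with y > 0, Γ⁴₄₄ (that is, Γᵖₚₚ) equals 2·(δ/γ)·(x/y)·q. -/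
open Matrix

/-- The metric matrix of the `G^J_1(ℝ)`-invariant metric on the extended
Siegel–Jacobi upper half plane `𝒳̃₁ᴶ` in coordinates
`(u 0, u 1, u 2, u 3, u 4) = (x, y, q, p, κ)`. -/
noncomputable def extSJmetric (α γ δ : ℝ) (u : Fin 5 → ℝ) : Matrix (Fin 5) (Fin 5) ℝ :=
  !![α / (u 1) ^ 2, 0, 0, 0, 0;
     0, α / (u 1) ^ 2, 0, 0, 0;
     0, 0, γ / (u 1) + δ * (u 3) ^ 2, γ * (u 0) / (u 1) - δ * (u 3) * (u 2), -(δ * (u 3));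
     0, 0, γ * (u 0) / (u 1) - δ * (u 3) * (u 2),
       γ * ((u 0) ^ 2 + (u 1) ^ 2) / (u 1) + δ * (u 2) ^ 2, δ * (u 2);
     0, 0, -(δ * (u 3)), δ * (u 2), δ]

/-- Partial derivative with respect to the `i`-th coordinate of `ℝ⁵`. -/
noncomputable def pderiv5 (i : Fin 5) (f : (Fin 5 → ℝ) → ℝ) (u : Fin 5 → ℝ) : ℝ :=
  fderiv ℝ f u (Pi.single i 1)

/-- Christoffel symbols of the second kind
`Γᵏᵢⱼ = (1/2)·Σₗ gᵏˡ(∂ᵢ gⱼₗ + ∂ⱼ gᵢₗ − ∂ₗ gᵢⱼ)` of the metric `extSJmetric`. -/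
noncomputable def extSJchristoffel (α γ δ : ℝ) (k i j : Fin 5) (u : Fin 5 → ℝ) : ℝ :=
  (1 / 2) * ∑ l : Fin 5, (extSJmetric α γ δ u)⁻¹ k l *
    (pderiv5 i (fun w => extSJmetric α γ δ w j l) u +
     pderiv5 j (fun w => extSJmetric α γ δ w i l) u -
     pderiv5 l (fun w => extSJmetric α γ δ w i j) u)

lemma extSJ_inv (α γ δ : ℝ) (hα : 0 < α) (hγ : 0 < γ) (hδ : 0 < δ)
    (u : Fin 5 → ℝ) (hy : 0 < u 1) :
    (extSJmetric α γ δ u)⁻¹ =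
  !![(u 1) ^ 2 / α, 0, 0, 0, 0;
     0, (u 1) ^ 2 / α, 0, 0, 0;
     0, 0, ((u 0)^2 + (u 1)^2) / (γ * u 1), -(u 0 / (γ * u 1)),
       (u 3 * ((u 0)^2 + (u 1)^2) + u 0 * u 2) / (γ * u 1);
     0, 0, -(u 0 / (γ * u 1)), 1 / (γ * u 1), -((u 3 * u 0 + u 2) / (γ * u 1));
     0, 0, (u 3 * ((u 0)^2 + (u 1)^2) + u 0 * u 2) / (γ * u 1),
       -((u 3 * u 0 + u 2) / (γ * u 1)),
       1 / δ + ((u 3)^2 * ((u 0)^2 + (u 1)^2) + 2 * u 3 * u 2 * u 0 + (u 2)^2) / (γ * u 1)] := by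
  apply Matrix.inv_eq_right_inv
  have h1 := hα.ne'
  have h2 := hγ.ne'
  have h3 := hδ.ne'
  have h4 := hy.ne'
  ext i j
  fin_cases i <;> fin_cases j <;>
    simp [extSJmetric, Matrix.mul_apply, Fin.sum_univ_five] <;> field_simp <;> ring

theorem christoffel_p_pp (α γ δ : ℝ) (hα : 0 < α) (hγ : 0 < γ) (hδ : 0 < δ)
    (u : Fin 5 → ℝ) (hy : 0 < u 1) :
    extSJchristoffel α γ δ 3 3 3 u = 2 * (δ / γ) * (u 0 / u 1) * u 2 := by
  have h4 := hy.ne'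
  have h2 := hγ.ne'
  have p (i : Fin 5) : HasFDerivAt (fun w : Fin 5 → ℝ => w i)
      (ContinuousLinearMap.proj (R := ℝ) (φ := fun _ : Fin 5 => ℝ) i) u := hasFDerivAt_apply i u
  have hi : HasFDerivAt (fun w : Fin 5 → ℝ => (w 1)⁻¹) _ u :=
    (hasDerivAt_inv h4).comp_hasFDerivAt u (p 1)
  have d32 : HasFDerivAt (fun w => extSJmetric α γ δ w 3 2) _ u :=
    (((p 0).const_mul γ).mul hi).sub (((p 3).const_mul δ).mul (p 2))
  have d33 : HasFDerivAt (fun w => extSJmetric α γ δ w 3 3) _ u :=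
    (((((p 0).pow 2).add ((p 1).pow 2)).const_mul γ).mul hi).add (((p 2).pow 2).const_mul δ)
  have d34 : HasFDerivAt (fun w => extSJmetric α γ δ w 3 4) _ u := (p 2).const_mul δ
  rw [extSJchristoffel, extSJ_inv α γ δ hα hγ hδ u hy]
  simp only [Fin.sum_univ_five, pderiv5, d32.fderiv, d33.fderiv, d34.fderiv]
  simp [Pi.single_apply]
  field_simp
  ring
end

section
/- Let n ≥ 1, let M ∈ Sp(n,ℝ) with n×n blocks M = [[a,b],[c,d]], let λ, μ ∈ M(1,n,ℝ) be row vectors, and let κ ∈ ℝ. Set p = λ dᵗ − μ cᵗ and q = −λ bᵗ + μ aᵗ. Let p', q' : ℝ → M(1,n,ℝ) and κ' : ℝ → ℝ be differentiable, and define p₁(t) = p + p'(t) dᵗ − q'(t) cᵗ, q₁(t) = q − p'(t) bᵗ + q'(t) aᵗ, κ₁(t) = κ + κ'(t) + λ q'(t)ᵗ − μ p'(t)ᵗ (identifying 1×1 matrices with scalars). Then for every t ∈ ℝ, (d/dt)κ₁(t) − p₁(t)(d/dt q₁(t))ᵗ + q₁(t)(d/dt p₁(t))ᵗ = (d/dt)κ'(t)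 − p'(t)(d/dt q'(t))ᵗ + q'(t)(d/dt p'(t))ᵗ. That is, the 1-form λᴿ = dκ − p dqᵗ + q dpᵗ is invariant under the action of the real Jacobi group G^J_n(ℝ) on the extended Siegel–Jacobi upper half space. -/
open Matrix

theorem jac_aux {n : ℕ} (X : ℝ → Matrix (Fin 1) (Fin n) ℝ)
    (hX : ∀ i j, Differentiable ℝ fun t => X t i j) (m : Matrix (Fin n) (Fin n) ℝ) (t : ℝ) (j : Fin n) :
    HasDerivAt (fun s => (X s * m) 0 j)
      (((Matrix.of fun i k => deriv (fun s => X s i k) t : Matrix (Fin 1) (Fin n) ℝ) * m) 0 j) t := by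
  simp only [Matrix.mul_apply, Matrix.of_apply]
  exact HasDerivAt.fun_sum fun k _ => ((hX 0 k) t).hasDerivAt.mul_const _

theorem jac_aux2 {n : ℕ} (X : ℝ → Matrix (Fin 1) (Fin n) ℝ)
    (hX : ∀ i j, Differentiable ℝ fun t => X t i j) (l : Matrix (Fin 1) (Fin n) ℝ) (t : ℝ) :
    HasDerivAt (fun s => (l * (X s)ᵀ) 0 0)
      ((l * (Matrix.of fun i k => deriv (fun s => X s i k) t : Matrix (Fin 1) (Fin n) ℝ)ᵀ) 0 0) t := by
  simp only [Matrix.mul_apply, Matrix.of_apply, Matrix.transpose_apply]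
  exact HasDerivAt.fun_sum fun k _ => ((hX 0 k) t).hasDerivAt.const_mul _

theorem jac_alg {n : ℕ} (a b c d : Matrix (Fin n) (Fin n) ℝ)
    (h1 : aᵀ * c = cᵀ * a) (h2 : aᵀ * d = 1 + cᵀ * b) (h3 : dᵀ * a = 1 + bᵀ * c)
    (h4 : bᵀ * d = dᵀ * b) (P Q x y : Matrix (Fin 1) (Fin n) ℝ) :
    (-(P * bᵀ) + Q * aᵀ) * (x * dᵀ - y * cᵀ)ᵀ - (P * dᵀ - Q * cᵀ) * (-(x * bᵀ) + y * aᵀ)ᵀ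
      = Q * xᵀ - P * yᵀ := by
  have e1 : Q * aᵀ * (c * yᵀ) = Q * cᵀ * (a * yᵀ) := by
    rw [Matrix.mul_assoc, ← Matrix.mul_assoc aᵀ, h1]; simp only [Matrix.mul_assoc]
  have e2 : Q * aᵀ * (d * xᵀ) = Q * xᵀ + Q * cᵀ * (b * xᵀ) := by
    rw [Matrix.mul_assoc, ← Matrix.mul_assoc aᵀ, h2]
    simp only [Matrix.mul_assoc, Matrix.add_mul, Matrix.mul_add, Matrix.one_mul]
  have e3 : P * dᵀ * (a * yᵀ) = P * yᵀ + P * bᵀ * (c * yᵀ) := by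
    rw [Matrix.mul_assoc, ← Matrix.mul_assoc dᵀ, h3]
    simp only [Matrix.mul_assoc, Matrix.add_mul, Matrix.mul_add, Matrix.one_mul]
  have e4 : P * bᵀ * (d * xᵀ) = P * dᵀ * (b * xᵀ) := by
    rw [Matrix.mul_assoc, ← Matrix.mul_assoc bᵀ, h4]; simp only [Matrix.mul_assoc]
  simp only [Matrix.transpose_add, Matrix.transpose_sub, Matrix.transpose_neg,
    Matrix.transpose_mul, Matrix.transpose_transpose, Matrix.add_mul, Matrix.mul_add,
    Matrix.sub_mul, Matrix.mul_sub, Matrix.neg_mul, Matrix.mul_neg, e1, e2, e3, e4]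
  abel

/-- The 1-form `λᴿ = dκ − p dqᵗ + q dpᵗ` is invariant under the action of the
real Jacobi group `G^J_n(ℝ)` on the extended Siegel–Jacobi upper half space. -/
theorem one_form_lambdaR_invariant
    (n : ℕ) (hn : 1 ≤ n) (a b c d : Matrix (Fin n) (Fin n) ℝ)
    (hM : (Matrix.fromBlocks a b c d)ᵀ *
        Matrix.fromBlocks (0 : Matrix (Fin n) (Fin n) ℝ) 1 (-1) 0 *
        Matrix.fromBlocks a b c d =
      Matrix.fromBlocks (0 : Matrix (Fin n) (Fin n) ℝ) 1 (-1) 0)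
    (lam mu : Matrix (Fin 1) (Fin n) ℝ) (κ : ℝ)
    (p' q' : ℝ → Matrix (Fin 1) (Fin n) ℝ) (κ' : ℝ → ℝ)
    (hp' : ∀ i j, Differentiable ℝ fun t => p' t i j)
    (hq' : ∀ i j, Differentiable ℝ fun t => q' t i j)
    (hκ' : Differentiable ℝ κ') :
    let p : Matrix (Fin 1) (Fin n) ℝ := lam * dᵀ - mu * cᵀ
    let q : Matrix (Fin 1) (Fin n) ℝ := -(lam * bᵀ) + mu * aᵀ
    let p₁ : ℝ → Matrix (Fin 1) (Fin n) ℝ := fun t => p + p' t * dᵀ - q' t * cᵀ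
    let q₁ : ℝ → Matrix (Fin 1) (Fin n) ℝ := fun t => q - p' t * bᵀ + q' t * aᵀ
    let κ₁ : ℝ → ℝ := fun t => κ + κ' t + (lam * (q' t)ᵀ) 0 0 - (mu * (p' t)ᵀ) 0 0
    ∀ t : ℝ,
      deriv κ₁ t - (∑ j, p₁ t 0 j * deriv (fun s => q₁ s 0 j) t) +
          (∑ j, q₁ t 0 j * deriv (fun s => p₁ s 0 j) t) =
        deriv κ' t - (∑ j, p' t 0 j * deriv (fun s => q' s 0 j) t) +
          (∑ j, q' t 0 j * deriv (fun s => p' s 0 j) t) := by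
  intro p q p₁ q₁ κ₁ t
  rw [Matrix.fromBlocks_transpose, Matrix.fromBlocks_multiply, Matrix.fromBlocks_multiply,
    Matrix.fromBlocks_inj] at hM
  simp only [Matrix.mul_zero, Matrix.mul_one, Matrix.mul_neg, zero_add, add_zero,
    Matrix.neg_mul] at hM
  obtain ⟨g1, g2, g3, g4⟩ := hM
  have h1 : aᵀ * c = cᵀ * a := by
    rw [← sub_eq_zero, ← g1]; abel
  have h2 : aᵀ * d = 1 + cᵀ * b := by
    rw [← g2]; abel
  have h3 : dᵀ * a = 1 + bᵀ * c := by
    have : (1 : Matrix (Fin n) (Fin n) ℝ) = -(-1) := by simp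
    rw [this, ← g3]; abel
  have h4 : bᵀ * d = dᵀ * b := by
    rw [← sub_eq_zero, ← g4]; abel
  set x : Matrix (Fin 1) (Fin n) ℝ := Matrix.of fun i k => deriv (fun s => p' s i k) t with hx
  set y : Matrix (Fin 1) (Fin n) ℝ := Matrix.of fun i k => deriv (fun s => q' s i k) t with hy
  have dp : ∀ j, deriv (fun s => p₁ s 0 j) t = (x * dᵀ - y * cᵀ) 0 j := fun j =>
    (((jac_aux p' hp' dᵀ t j).const_add (p 0 j)).sub (jac_aux q' hq' cᵀ t j)).deriv
  have dq : ∀ j, deriv (fun s => q₁ s 0 j) t = (-(x * bᵀ) + y * aᵀ) 0 j := fun j =>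
    (((jac_aux p' hp' bᵀ t j).const_sub (q 0 j)).add (jac_aux q' hq' aᵀ t j)).deriv
  have dk : deriv κ₁ t = deriv κ' t + (lam * yᵀ) 0 0 - (mu * xᵀ) 0 0 :=
    ((((hκ' t).hasDerivAt.const_add κ).add (jac_aux2 q' hq' lam t)).sub
      (jac_aux2 p' hp' mu t)).deriv
  have key := jac_alg a b c d h1 h2 h3 h4 (lam + p' t) (mu + q' t) x y
  have ep : (lam + p' t) * dᵀ - (mu + q' t) * cᵀ = p₁ t := by
    simp only [p₁, p, Matrix.add_mul]; abel
  have eq : -((lam + p' t) * bᵀ) + (mu + q' t) * aᵀ = q₁ t := by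
    simp only [q₁, q, Matrix.add_mul]; abel
  rw [ep, eq] at key
  have k0 := congrFun (congrFun key 0) 0
  have s1 : ∀ U V : Matrix (Fin 1) (Fin n) ℝ, ∑ j, U 0 j * V 0 j = (U * Vᵀ) 0 0 := fun U V => by
    simp [Matrix.mul_apply]
  have r1 : ∑ j, p' t 0 j * deriv (fun s => q' s 0 j) t = (p' t * yᵀ) 0 0 := s1 (p' t) y
  have r2 : ∑ j, q' t 0 j * deriv (fun s => p' s 0 j) t = (q' t * xᵀ) 0 0 := s1 (q' t) x
  simp only [dp, dq]
  rw [s1, s1, r1, r2, dk]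
  rw [Matrix.sub_apply, Matrix.sub_apply, Matrix.add_mul mu, Matrix.add_mul lam, Matrix.add_apply (mu * xᵀ),
    Matrix.add_apply (lam * yᵀ)] at k0
  linarith
end

section
/- Let n ≥ 1 and let M ∈ Sp(n,ℝ) with n×n blocks M = [[a,b],[c,d]]. Let v : ℝ → M(n,ℂ) be a differentiable curve such that for every t, v(t) is symmetric, Im v(t) is positive definite, and c v(t) + d is invertible. Define v₁(t) = (a v(t) + b)(c v(t) + d)⁻¹ and write x = Re v, y = Im v, x₁ = Re v₁, y₁ = Im v₁. Then for every t ∈ ℝ, tr[(y₁(t)⁻¹ x₁'(t))² + (y₁(t)⁻¹ y₁'(t))²] = tr[(y(t)⁻¹ x'(t))² + (y(t)⁻¹ y'(t))²], where ' denotes d/dt. That is, the Siegel metric α·tr[(y⁻¹dx)² + (y⁻¹dy)²] is invariant under the Möbius action of Sp(n,ℝ) on the Siegel upper half space 𝒳ₙ. -/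
open Matrix

section SiegelCalc
attribute [local instance] Matrix.linftyOpNormedRing Matrix.linftyOpNormedAlgebra

theorem siegel_hasDerivAt_iff {n : ℕ} (f : ℝ → Matrix (Fin n) (Fin n) ℂ)
    (f' : Matrix (Fin n) (Fin n) ℂ) (t : ℝ) :
    HasDerivAt f f' t ↔ ∀ i j, HasDerivAt (fun s => f s i j) (f' i j) t := by
  constructor
  · intro h i j
    let L : Matrix (Fin n) (Fin n) ℂ →ₗ[ℝ] ℂ :=
      { toFun := fun M => M i j, map_add' := fun _ _ => rfl, map_smul' := fun _ _ => rfl }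
    exact (LinearMap.toContinuousLinearMap L).hasFDerivAt.comp_hasDerivAt t h
  · intro h
    have key : ∀ M : Matrix (Fin n) (Fin n) ℂ,
        M = ∑ i, ∑ j, M i j • Matrix.single i j (1:ℂ) := by
      intro M
      conv_lhs => rw [Matrix.matrix_eq_sum_single M]
      simp [Matrix.smul_single]
    have h2 : HasDerivAt (fun s => ∑ i, ∑ j, f s i j • Matrix.single i j (1:ℂ))
        (∑ i, ∑ j, f' i j • Matrix.single i j (1:ℂ)) t := by
      refine HasDerivAt.fun_sum fun i _ => HasDerivAt.fun_sum fun j _ => ?_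
      exact (h i j).smul_const _
    rw [← key f'] at h2
    have : f = (fun s => ∑ i, ∑ j, f s i j • Matrix.single i j (1:ℂ)) :=
      funext fun s => key (f s)
    rw [this]; exact h2

theorem siegel_deriv {n : ℕ} (A B C D : Matrix (Fin n) (Fin n) ℂ)
    (v : ℝ → Matrix (Fin n) (Fin n) ℂ) (v' : Matrix (Fin n) (Fin n) ℂ) (t : ℝ)
    (h : ∀ i j, HasDerivAt (fun s => v s i j) (v' i j) t)
    (hq : IsUnit (C * v t + D)) :
    ∀ i j, HasDerivAt (fun s => ((A * v s + B) * (C * v s + D)⁻¹) i j)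
      (((A - (A * v t + B) * (C * v t + D)⁻¹ * C) * v' * (C * v t + D)⁻¹) i j) t := by
  have hv := (siegel_hasDerivAt_iff v v' t).2 h
  have hp : HasDerivAt (fun s => A * v s + B) (A * v') t := (hv.const_mul A).add_const B
  have hq' : HasDerivAt (fun s => C * v s + D) (C * v') t := (hv.const_mul C).add_const D
  obtain ⟨u, hu⟩ := hq
  have hr := hasFDerivAt_ringInverse (𝕜 := ℝ) u
  rw [hu] at hr
  have hr2 := hr.comp_hasDerivAt t hq'
  have hm := hp.mul hr2
  have hui : (↑u⁻¹ : Matrix (Fin n) (Fin n) ℂ) = (C * v t + D)⁻¹ := by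
    rw [← hu, Matrix.coe_units_inv]
  refine (siegel_hasDerivAt_iff _ _ t).1 ?_
  have hf : (fun s => (A * v s + B) * (C * v s + D)⁻¹) =
      (fun s => A * v s + B) * (Ring.inverse ∘ fun s => C * v s + D) := by
    funext s
    simp [Matrix.nonsing_inv_eq_ringInverse]
  rw [hf]
  have he : (A - (A * v t + B) * (C * v t + D)⁻¹ * C) * v' * (C * v t + D)⁻¹ =
      A * v' * (C * v t + D)⁻¹ + (A * v t + B) *
        (-((C * v t + D)⁻¹ * (C * v') * (C * v t + D)⁻¹)) := by
    noncomm_ring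
  rw [he, ← hui]
  have hi : (Ring.inverse ∘ fun s => C * v s + D) t = (↑u⁻¹ : Matrix (Fin n) (Fin n) ℂ) := by
    simp only [Function.comp_apply]
    rw [hui, Matrix.nonsing_inv_eq_ringInverse]
  rw [hi] at hm
  exact hm
end SiegelCalc

theorem siegel_trace {n : ℕ} (Y X Z : Matrix (Fin n) (Fin n) ℝ) :
    (((Y * X) ^ 2 + (Y * Z) ^ 2).trace : ℂ) =
    (Y.map Complex.ofReal * (X.map Complex.ofReal + Complex.I • Z.map Complex.ofReal) *
      (Y.map Complex.ofReal *
        (X.map Complex.ofReal - Complex.I • Z.map Complex.ofReal))).trace := by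
  have h1 : (((Y * X) ^ 2 + (Y * Z) ^ 2).trace : ℂ) =
      (((Y * X) ^ 2 + (Y * Z) ^ 2).map Complex.ofReal).trace := by
    simp [Matrix.trace]
  rw [h1]
  have h2 : (((Y * X) ^ 2 + (Y * Z) ^ 2).map Complex.ofReal) =
      (Y.map Complex.ofReal * X.map Complex.ofReal) ^ 2 +
      (Y.map Complex.ofReal * Z.map Complex.ofReal) ^ 2 := by
    change Complex.ofRealHom.mapMatrix _ = _
    simp only [map_add, map_pow, map_mul]
    rfl
  rw [h2]
  generalize Y.map Complex.ofReal = Y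
  generalize X.map Complex.ofReal = X
  generalize Z.map Complex.ofReal = Z
  have h3 : Y * (X + Complex.I • Z) * (Y * (X - Complex.I • Z)) =
      (Y * X) ^ 2 + (Y * Z) ^ 2 + Complex.I • ((Y * Z) * (Y * X) - (Y * X) * (Y * Z)) := by
    simp only [mul_add, mul_sub, add_mul, Matrix.mul_smul, Matrix.smul_mul, smul_smul,
      Complex.I_mul_I, smul_sub, pow_two, neg_smul, one_smul]
    abel
  rw [h3, Matrix.trace_add _ (Complex.I • _), Matrix.trace_smul, Matrix.trace_sub, Matrix.trace_mul_comm (Y * Z)]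
  simp

/-- Pure algebra over ℂ. `qb`, `vb`, `pb` are conjugates. -/
theorem siegel_alg {n : ℕ} (A B C D v vb W Wb y y1 : Matrix (Fin n) (Fin n) ℂ)
    (h1 : Aᵀ * C = Cᵀ * A) (h2 : Bᵀ * D = Dᵀ * B) (h3 : Aᵀ * D - Cᵀ * B = 1)
    (hv : vᵀ = v) (hvb : vbᵀ = vb) (hy : v - vb = (2 * Complex.I) • y)
    (hq : IsUnit (C * v + D)) (hqb : IsUnit (C * vb + D))
    (hy1 : (A * v + B) * (C * v + D)⁻¹ - (A * vb + B) * (C * vb + D)⁻¹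
      = (2 * Complex.I) • y1) :
    (y1⁻¹ * ((A - (A * v + B) * (C * v + D)⁻¹ * C) * W * (C * v + D)⁻¹) *
      (y1⁻¹ * ((A - (A * vb + B) * (C * vb + D)⁻¹ * C) * Wb * (C * vb + D)⁻¹))).trace
    = (y⁻¹ * W * (y⁻¹ * Wb)).trace := by
  have h3' : Dᵀ * A - Bᵀ * C = 1 := by
    have := congrArg Matrix.transpose h3
    simpa using this
  -- symmetry of the Moebius image
  have key : ∀ w : Matrix (Fin n) (Fin n) ℂ, wᵀ = w → IsUnit (C * w + D) →
      (A * w + B) * (C * w + D)⁻¹ = ((C * w + D)ᵀ)⁻¹ * (A * w + B)ᵀ ∧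
      A - (A * w + B) * (C * w + D)⁻¹ * C = ((C * w + D)ᵀ)⁻¹ := by
    intro w hw hu
    have hd : IsUnit (C * w + D).det := (Matrix.isUnit_iff_isUnit_det _).1 hu
    have hdt : IsUnit ((C * w + D)ᵀ).det := by rwa [Matrix.det_transpose]
    have e1 : (C * w + D)ᵀ * (A * w + B) = (A * w + B)ᵀ * (C * w + D) := by
      rw [← sub_eq_zero]
      simp only [Matrix.transpose_add, Matrix.transpose_mul, hw]
      calc _ = - (w * (Aᵀ * C - Cᵀ * A) * w) - (w * (Aᵀ * D - Cᵀ * B))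
              + (Dᵀ * A - Bᵀ * C) * w - (Bᵀ * D - Dᵀ * B) := by noncomm_ring
        _ = 0 := by rw [h1, h2, h3, h3']; simp
    have e2 : (A * w + B) * (C * w + D)⁻¹ = ((C * w + D)ᵀ)⁻¹ * (A * w + B)ᵀ := by
      calc _ = ((C * w + D)ᵀ)⁻¹ * ((C * w + D)ᵀ * (A * w + B)) * (C * w + D)⁻¹ := by
            rw [Matrix.nonsing_inv_mul_cancel_left _ _ hdt]
        _ = _ := by
            rw [e1, mul_assoc, Matrix.mul_nonsing_inv_cancel_right _ _ hd]
    refine ⟨e2, ?_⟩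
    rw [e2]
    have e3 : (C * w + D)ᵀ * A - (A * w + B)ᵀ * C = 1 := by
      simp only [Matrix.transpose_add, Matrix.transpose_mul, hw]
      calc _ = - (w * (Aᵀ * C - Cᵀ * A)) + (Dᵀ * A - Bᵀ * C) := by noncomm_ring
        _ = 1 := by rw [h1, h3']; simp
    calc _ = ((C * w + D)ᵀ)⁻¹ * ((C * w + D)ᵀ * A) - ((C * w + D)ᵀ)⁻¹ * ((A * w + B)ᵀ * C) := by
            rw [Matrix.nonsing_inv_mul_cancel_left _ _ hdt, mul_assoc]
      _ = _ := by rw [← mul_sub, e3, mul_one]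
  -- two-point formula
  have two : ∀ w z : Matrix (Fin n) (Fin n) ℂ, wᵀ = w → zᵀ = z → IsUnit (C * w + D) →
      IsUnit (C * z + D) →
      (A * w + B) * (C * w + D)⁻¹ - (A * z + B) * (C * z + D)⁻¹ =
      ((C * z + D)ᵀ)⁻¹ * (w - z) * (C * w + D)⁻¹ := by
    intro w z hw hz hu hu'
    have hd : IsUnit (C * w + D).det := (Matrix.isUnit_iff_isUnit_det _).1 hu
    have hdt : IsUnit ((C * z + D)ᵀ).det := by
      rw [Matrix.det_transpose]; exact (Matrix.isUnit_iff_isUnit_det _).1 hu'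
    rw [(key z hz hu').1]
    have e : (C * z + D)ᵀ * (A * w + B) - (A * z + B)ᵀ * (C * w + D) = w - z := by
      simp only [Matrix.transpose_add, Matrix.transpose_mul, hz]
      calc _ = - (z * (Aᵀ * C - Cᵀ * A) * w) - (z * (Aᵀ * D - Cᵀ * B))
              + (Dᵀ * A - Bᵀ * C) * w - (Bᵀ * D - Dᵀ * B) := by noncomm_ring
        _ = w - z := by rw [h1, h2, h3, h3']; simp; abel
    rw [← e, mul_sub, sub_mul, Matrix.nonsing_inv_mul_cancel_left _ _ hdt, ← mul_assoc,
      Matrix.mul_nonsing_inv_cancel_right _ _ hd]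
  have k1 := (key v hv hq).2
  have k2 := (key vb hvb hqb).2
  have t1 := two v vb hv hvb hq hqb
  have t2 := two vb v hvb hv hqb hq
  have hI : (2 * Complex.I) ≠ 0 := by simp
  have y1a : y1 = ((C * vb + D)ᵀ)⁻¹ * y * (C * v + D)⁻¹ := by
    rw [hy1, hy, Matrix.mul_smul, Matrix.smul_mul] at t1
    exact smul_right_injective _ hI t1
  have y1b : y1 = ((C * v + D)ᵀ)⁻¹ * y * (C * vb + D)⁻¹ := by
    rw [← neg_sub, hy1, ← neg_sub v, hy, mul_neg, neg_mul, Matrix.mul_smul, Matrix.smul_mul,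
      neg_inj] at t2
    exact smul_right_injective _ hI t2
  rw [k1, k2]
  have hd : IsUnit (C * v + D).det := (Matrix.isUnit_iff_isUnit_det _).1 hq
  have hdb : IsUnit (C * vb + D).det := (Matrix.isUnit_iff_isUnit_det _).1 hqb
  generalize C * v + D = q at *
  generalize C * vb + D = qb at *
  have hdt : IsUnit (qᵀ).det := by rwa [Matrix.det_transpose]
  have hdbt : IsUnit (qbᵀ).det := by rwa [Matrix.det_transpose]
  have i1 : y1⁻¹ = q * (y⁻¹ * qbᵀ) := by
    rw [y1a, Matrix.mul_inv_rev, Matrix.mul_inv_rev, Matrix.nonsing_inv_nonsing_inv _ hd,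
      Matrix.nonsing_inv_nonsing_inv _ hdbt]
  have i2 : y1⁻¹ = qb * (y⁻¹ * qᵀ) := by
    rw [y1b, Matrix.mul_inv_rev, Matrix.mul_inv_rev, Matrix.nonsing_inv_nonsing_inv _ hdb,
      Matrix.nonsing_inv_nonsing_inv _ hdt]
  have f1 : y1⁻¹ * ((qᵀ)⁻¹ * W * q⁻¹) = qb * (y⁻¹ * W * q⁻¹) := by
    rw [i2]; simp only [mul_assoc]; rw [Matrix.mul_nonsing_inv_cancel_left _ _ hdt]
  have f2 : y1⁻¹ * ((qbᵀ)⁻¹ * Wb * qb⁻¹) = q * (y⁻¹ * Wb * qb⁻¹) := by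
    rw [i1]; simp only [mul_assoc]; rw [Matrix.mul_nonsing_inv_cancel_left _ _ hdbt]
  rw [f1, f2, mul_assoc qb, Matrix.trace_mul_comm qb]
  simp only [mul_assoc]
  rw [Matrix.nonsing_inv_mul_cancel_left _ _ hd, Matrix.nonsing_inv_mul _ hdb, mul_one]

theorem siegel_map_inv {n : ℕ} (f : ℂ →+* ℂ) (M : Matrix (Fin n) (Fin n) ℂ) (h : IsUnit M) :
    (M⁻¹).map f = (M.map f)⁻¹ := by
  symm
  apply Matrix.inv_eq_left_inv
  rw [← Matrix.map_mul, Matrix.nonsing_inv_mul _ ((Matrix.isUnit_iff_isUnit_det _).1 h)]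
  simp

theorem siegel_map_inv_real {n : ℕ} (M : Matrix (Fin n) (Fin n) ℝ) :
    (M⁻¹).map Complex.ofReal = (M.map Complex.ofReal)⁻¹ := by
  change Complex.ofRealHom.mapMatrix _ = (Complex.ofRealHom.mapMatrix M)⁻¹
  by_cases h : IsUnit M.det
  · symm
    apply Matrix.inv_eq_left_inv
    rw [← map_mul, Matrix.nonsing_inv_mul _ h, map_one]
  · rw [Matrix.nonsing_inv_apply_not_isUnit _ h, Matrix.nonsing_inv_apply_not_isUnit, map_zero]
    rw [← RingHom.map_det]
    simpa [isUnit_iff_ne_zero] using h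

/-- The Siegel metric `tr[(y⁻¹dx)² + (y⁻¹dy)²]` is invariant under the Möbius
action of `Sp(n,ℝ)` on the Siegel upper half space `𝒳ₙ`. -/
theorem siegel_metric_invariant
    (n : ℕ) (hn : 1 ≤ n) (a b c d : Matrix (Fin n) (Fin n) ℝ)
    (hM : (Matrix.fromBlocks a b c d)ᵀ *
        Matrix.fromBlocks (0 : Matrix (Fin n) (Fin n) ℝ) 1 (-1) 0 *
        Matrix.fromBlocks a b c d =
      Matrix.fromBlocks (0 : Matrix (Fin n) (Fin n) ℝ) 1 (-1) 0)
    (v : ℝ → Matrix (Fin n) (Fin n) ℂ)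
    (hdiff : ∀ i j, Differentiable ℝ fun t => v t i j)
    (hsymm : ∀ t, (v t)ᵀ = v t)
    (hpos : ∀ t, (Matrix.of fun i j => (v t i j).im).PosDef)
    (hinv : ∀ t, IsUnit (c.map Complex.ofReal * v t + d.map Complex.ofReal)) :
    let v₁ : ℝ → Matrix (Fin n) (Fin n) ℂ := fun s =>
      (a.map Complex.ofReal * v s + b.map Complex.ofReal) *
        (c.map Complex.ofReal * v s + d.map Complex.ofReal)⁻¹
    let y : ℝ → Matrix (Fin n) (Fin n) ℝ := fun s => Matrix.of fun i j => (v s i j).im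
    let y₁ : ℝ → Matrix (Fin n) (Fin n) ℝ := fun s => Matrix.of fun i j => (v₁ s i j).im
    ∀ t : ℝ,
      let dx : Matrix (Fin n) (Fin n) ℝ :=
        Matrix.of fun i j => deriv (fun s => (v s i j).re) t
      let dy : Matrix (Fin n) (Fin n) ℝ :=
        Matrix.of fun i j => deriv (fun s => (v s i j).im) t
      let dx₁ : Matrix (Fin n) (Fin n) ℝ :=
        Matrix.of fun i j => deriv (fun s => (v₁ s i j).re) t
      let dy₁ : Matrix (Fin n) (Fin n) ℝ :=
        Matrix.of fun i j => deriv (fun s => (v₁ s i j).im) t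
      (((y₁ t)⁻¹ * dx₁) ^ 2 + ((y₁ t)⁻¹ * dy₁) ^ 2).trace =
        (((y t)⁻¹ * dx) ^ 2 + ((y t)⁻¹ * dy) ^ 2).trace := by
  intro v₁ y y₁ t dx dy dx₁ dy₁
  have hblk := hM
  simp only [Matrix.fromBlocks_transpose, Matrix.fromBlocks_multiply, Matrix.fromBlocks_inj] at hblk
  obtain ⟨b1, b2, -, b4⟩ := hblk
  set A := a.map Complex.ofReal with hA
  set B := b.map Complex.ofReal with hB
  set C := c.map Complex.ofReal with hC
  set D := d.map Complex.ofReal with hD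
  have lift : ∀ P Q R S T : Matrix (Fin n) (Fin n) ℝ, Pᵀ * Q - Rᵀ * S = T →
      (P.map Complex.ofReal)ᵀ * Q.map Complex.ofReal -
        (R.map Complex.ofReal)ᵀ * S.map Complex.ofReal = T.map Complex.ofReal := by
    intro P Q R S T h
    rw [← h]
    change _ = Complex.ofRealHom.mapMatrix _
    rw [map_sub, map_mul, map_mul]
    rfl
  have h1 : Aᵀ * C = Cᵀ * A := by
    have := lift a c c a 0 (by rw [← b1]; noncomm_ring)
    rw [← sub_eq_zero, this]; ext; simp
  have h2 : Bᵀ * D = Dᵀ * B := by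
    have := lift b d d b 0 (by rw [← b4]; noncomm_ring)
    rw [← sub_eq_zero, this]; ext; simp
  have h3 : Aᵀ * D - Cᵀ * B = 1 := by
    have := lift a d c b 1 (by rw [← b2]; noncomm_ring)
    rw [this]; simp
  let V : Matrix (Fin n) (Fin n) ℂ := Matrix.of fun i j => deriv (fun s => v s i j) t
  have hV : ∀ i j, HasDerivAt (fun s => v s i j) (V i j) t :=
    fun i j => (hdiff i j t).hasDerivAt
  have hV1 := siegel_deriv A B C D v V t hV (hinv t)
  let cj : ℂ →+* ℂ := starRingEnd ℂ
  have re_d : ∀ (f : ℝ → ℂ) (f' : ℂ), HasDerivAt f f' t →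
      deriv (fun s => (f s).re) t = f'.re := fun f f' h =>
    (Complex.reCLM.hasFDerivAt.comp_hasDerivAt t h).deriv
  have im_d : ∀ (f : ℝ → ℂ) (f' : ℂ), HasDerivAt f f' t →
      deriv (fun s => (f s).im) t = f'.im := fun f f' h =>
    (Complex.imCLM.hasFDerivAt.comp_hasDerivAt t h).deriv
  have cjr : ∀ P : Matrix (Fin n) (Fin n) ℝ,
      (P.map Complex.ofReal).map cj = P.map Complex.ofReal := by
    intro P; ext i j; simp [cj]
  set V1 := (A - (A * v t + B) * (C * v t + D)⁻¹ * C) * V * (C * v t + D)⁻¹ with hV1def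
  have cq : (C * v t + D).map cj = C * (v t).map cj + D := by
    rw [Matrix.map_add _ (map_add cj), Matrix.map_mul, hC, hD, cjr, cjr]
  have cp : (A * v t + B).map cj = A * (v t).map cj + B := by
    rw [Matrix.map_add _ (map_add cj), Matrix.map_mul, hA, hB, cjr, cjr]
  have cqi : ((C * v t + D)⁻¹).map cj = (C * (v t).map cj + D)⁻¹ := by
    rw [siegel_map_inv _ _ (hinv t), cq]
  have cv1 : (v₁ t).map cj = (A * (v t).map cj + B) * (C * (v t).map cj + D)⁻¹ := by
    change ((A * v t + B) * (C * v t + D)⁻¹).map cj = _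
    rw [Matrix.map_mul, cp, cqi]
  have cV1 : V1.map cj = (A - (A * (v t).map cj + B) * (C * (v t).map cj + D)⁻¹ * C) *
      V.map cj * (C * (v t).map cj + D)⁻¹ := by
    rw [hV1def, Matrix.map_mul, Matrix.map_mul, Matrix.map_sub _ (map_sub cj), Matrix.map_mul,
      Matrix.map_mul, cp, cqi, hA, hC, cjr, cjr]
  have dec : ∀ (P Q : Matrix (Fin n) (Fin n) ℝ) (R : Matrix (Fin n) (Fin n) ℂ),
      (∀ i j, P i j = (R i j).re) → (∀ i j, Q i j = (R i j).im) →
      P.map Complex.ofReal + Complex.I • Q.map Complex.ofReal = R ∧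
      P.map Complex.ofReal - Complex.I • Q.map Complex.ofReal = R.map cj := by
    intro P Q R hP hQ
    constructor
    · ext i j
      apply Complex.ext <;> simp [hP, hQ]
    · ext i j
      apply Complex.ext <;> simp [hP, hQ, cj]
  obtain ⟨p1, p2⟩ := dec dx dy V (fun i j => re_d _ _ (hV i j)) (fun i j => im_d _ _ (hV i j))
  obtain ⟨q1, q2⟩ := dec dx₁ dy₁ V1 (fun i j => re_d _ _ (hV1 i j))
    (fun i j => im_d _ _ (hV1 i j))
  have imf : ∀ R : Matrix (Fin n) (Fin n) ℂ, R - R.map cj =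
      (2 * Complex.I) • (Matrix.of fun i j => (R i j).im : Matrix (Fin n) (Fin n) ℝ).map
        Complex.ofReal := by
    intro R
    ext i j
    apply Complex.ext <;> simp [cj]
    ring
  apply Complex.ofReal_injective
  rw [siegel_trace, siegel_trace, p1, p2, q1, q2, siegel_map_inv_real, siegel_map_inv_real, cV1]
  have uy : IsUnit ((y t).map Complex.ofReal) :=
    (hpos t).isUnit.map Complex.ofRealHom.mapMatrix
  have uqb : IsUnit (C * (v t).map cj + D) := by
    rw [← cq]
    exact (hinv t).map cj.mapMatrix
  refine siegel_alg A B C D (v t) ((v t).map cj) V (V.map cj) _ _ h1 h2 h3 (hsymm t) ?_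
    (imf (v t)) (hinv t) uqb ?_
  · rw [← Matrix.transpose_map, hsymm t]
  · rw [← cv1]
    exact imf (v₁ t)
end

section
/- Let n ≥ 1 and let M ∈ Sp(n,ℝ) with n×n blocks M = [[a,b],[c,d]]. Let v : ℝ → M(n,ℂ) be a differentiable curve such that for every t, v(t) is symmetric, y(t) := Im v(t) is positive definite, and c v(t) + d is invertible; set x = Re v, v₁(t) = (a v(t) + b)(c v(t) + d)⁻¹, x₁ = Re v₁, y₁ = Im v₁. Let p', q' : ℝ → M(1,n,ℝ) be differentiable row-vector curves, let p₀, q₀ ∈ M(1,n,ℝ) be constants, and define p₁(t) = p₀ + p'(t) dᵗ − q'(t) cᵗ, q₁(t) = q₀ − p'(t) bᵗ + q'(t) aᵗ. Then for every t ∈ ℝ (writing p₁'(t), q₁'(t) for the t-derivatives of p₁, q₁ and identifying 1×1 matrices with scalars): p₁'(t)(y₁(t) + x₁(t) y₁(t)⁻¹ x₁(t))(p₁'(t))ᵗ + q₁'(t) y₁(t)⁻¹ (q₁'(t))ᵗ + 2 p₁'(t) x₁(t) y₁(t)⁻¹ (q₁'(t))ᵗ = (d/dt p'(t))(y(t) +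 x(t) y(t)⁻¹ x(t))(d/dt p'(t))ᵗ + (d/dt q'(t)) y(t)⁻¹ (d/dt q'(t))ᵗ + 2 (d/dt p'(t)) x(t) y(t)⁻¹ (d/dt q'(t))ᵗ. -/
open Matrix

lemma jac_aux_ring {R : Type*} [Ring R] (a b c d a' b' c' d' u w : R)
    (h1 : a' * c = c' * a) (h2 : b' * d = d' * b) (h3 : a' * d - c' * b = 1)
    (h4 : d' * a - b' * c = 1) :
    (w * c' + d') * (a * u + b) - (w * a' + b') * (c * u + d) = u - w := by
  have e : (w * c' + d') * (a * u + b) - (w * a' + b') * (c * u + d)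
     = w * (c' * a - a' * c) * u - w * (a' * d - c' * b) + (d' * a - b' * c) * u
       + (d' * b - b' * d) := by noncomm_ring
  rw [e, h1, h2, h3, h4]; noncomm_ring

lemma jac_form {n : ℕ} (V : Matrix (Fin n) (Fin n) ℂ) (x y : Matrix (Fin n) (Fin n) ℝ)
    (hx : xᵀ = x) (hy : yᵀ = y) (hu : IsUnit y)
    (hV : V = x.map Complex.ofReal + Complex.I • y.map Complex.ofReal)
    (p q : Matrix (Fin 1) (Fin n) ℝ) :
    (((p * (y + x * y⁻¹ * x) * pᵀ + q * y⁻¹ * qᵀ +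
          (2 : ℝ) • (p * (x * y⁻¹) * qᵀ)) 0 0 : ℝ) : ℂ) =
     ((p.map Complex.ofReal * V + q.map Complex.ofReal) * (y.map Complex.ofReal)⁻¹ *
       (p.map Complex.ofReal * V + q.map Complex.ofReal)ᴴ) 0 0 := by
  have hd : IsUnit y.det := (Matrix.isUnit_iff_isUnit_det y).1 hu
  have hm1 : (y.map Complex.ofReal) * (y⁻¹.map Complex.ofReal) = 1 := by
    have := congrArg (fun m => m.map Complex.ofRealHom) (Matrix.mul_nonsing_inv y hd)
    rw [Matrix.map_mul, Matrix.map_one _ (map_zero _) (map_one _)] at this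
    exact this
  have hyi : (y.map Complex.ofReal)⁻¹ = y⁻¹.map Complex.ofReal := Matrix.inv_eq_right_inv hm1
  have hm2 : (y⁻¹.map Complex.ofReal) * (y.map Complex.ofReal) = 1 := mul_eq_one_comm.1 hm1
  have hW : p.map Complex.ofReal * V + q.map Complex.ofReal
      = (p * x + q).map Complex.ofReal + Complex.I • (p * y).map Complex.ofReal := by
    have e1 : (p * x + q).map Complex.ofReal = p.map Complex.ofReal * x.map Complex.ofReal + q.map Complex.ofReal := by
      ext i j; simp [Matrix.mul_apply]
    have e2 : (p * y).map Complex.ofReal = p.map Complex.ofReal * y.map Complex.ofReal := by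
      ext i j; simp [Matrix.mul_apply]
    rw [hV, e1, e2, Matrix.mul_add, Matrix.mul_smul]; abel
  have hWH : (p.map Complex.ofReal * V + q.map Complex.ofReal)ᴴ
      = ((p * x + q)ᵀ).map Complex.ofReal - Complex.I • ((p * y)ᵀ).map Complex.ofReal := by
    rw [hW]; ext i j; simp [sub_eq_add_neg, -Matrix.transpose_mul]
  rw [hWH, hW, hyi]
  have mm : ∀ {k l m : ℕ} (A : Matrix (Fin k) (Fin l) ℝ) (B : Matrix (Fin l) (Fin m) ℝ),
     A.map Complex.ofReal * B.map Complex.ofReal = (A * B).map Complex.ofReal := by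
    intro k l m A B; ext i j; simp [Matrix.mul_apply]
  rw [Matrix.add_mul, Matrix.add_mul]
  simp only [Matrix.mul_sub, Matrix.smul_mul, Matrix.mul_smul, mm]
  have r1 : p * y * y⁻¹ = p := by rw [Matrix.mul_assoc, Matrix.mul_nonsing_inv y hd, Matrix.mul_one]
  have r2 : (p * x + q) * y⁻¹ * (p * y)ᵀ = (p * x + q) * pᵀ := by
    rw [Matrix.transpose_mul, hy, Matrix.mul_assoc, ← Matrix.mul_assoc y⁻¹, Matrix.nonsing_inv_mul y hd, Matrix.one_mul]
  have t : ∀ A : Matrix (Fin 1) (Fin 1) ℝ, Aᵀ 0 0 = A 0 0 := fun A => rfl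
  have r3 : (p * (p * x + q)ᵀ) 0 0 = ((p * x + q) * pᵀ) 0 0 := by
    rw [← t (p * (p * x + q)ᵀ), Matrix.transpose_mul, Matrix.transpose_transpose]
  have r4 : p * (p * y)ᵀ = p * y * pᵀ := by
    rw [Matrix.transpose_mul, hy, Matrix.mul_assoc]
  have hyit : (y⁻¹)ᵀ = y⁻¹ := by rw [Matrix.transpose_nonsing_inv, hy]
  have r5 : (q * (y⁻¹ * (x * pᵀ))) 0 0 = (p * (x * (y⁻¹ * qᵀ))) 0 0 := by
    rw [← t (q * (y⁻¹ * (x * pᵀ)))]; simp only [Matrix.transpose_mul, Matrix.transpose_transpose, hyit, hx, Matrix.mul_assoc]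
  have r6 : ((p * x + q) * y⁻¹ * (p * x + q)ᵀ) 0 0 = (p * (x * y⁻¹ * x) * pᵀ) 0 0 + (q * y⁻¹ * qᵀ) 0 0 + 2 * (p * (x * y⁻¹) * qᵀ) 0 0 := by
    simp only [Matrix.transpose_add, Matrix.transpose_mul, hx, Matrix.add_mul, Matrix.mul_add, Matrix.mul_assoc, Matrix.add_apply]
    rw [r5]; ring
  simp only [Matrix.add_apply, Matrix.sub_apply, Matrix.smul_apply, Matrix.map_apply, smul_eq_mul, r1, r2, r3, r4, r6]
  rw [Matrix.mul_add, Matrix.add_mul, Matrix.add_apply]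
  have := Complex.I_mul_I
  push_cast
  linear_combination ((p * y * pᵀ) 0 0 : ℂ) * this

/-- The term `γ·[dp (y + x y⁻¹ x) dpᵗ + dq y⁻¹ dqᵗ + 2 dp x y⁻¹ dqᵗ]` of the
invariant metric on the Siegel–Jacobi upper half space `𝒳ₙᴶ` is invariant under
the action of the restricted real Jacobi group `G^J_n(ℝ)₀`. -/
theorem jacobi_metric_pq_term_invariant
    (n : ℕ) (hn : 1 ≤ n) (a b c d : Matrix (Fin n) (Fin n) ℝ)
    (hM : (Matrix.fromBlocks a b c d)ᵀ *
        Matrix.fromBlocks (0 : Matrix (Fin n) (Fin n) ℝ) 1 (-1) 0 *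
        Matrix.fromBlocks a b c d =
      Matrix.fromBlocks (0 : Matrix (Fin n) (Fin n) ℝ) 1 (-1) 0)
    (v : ℝ → Matrix (Fin n) (Fin n) ℂ)
    (hdiff : ∀ i j, Differentiable ℝ fun t => v t i j)
    (hsymm : ∀ t, (v t)ᵀ = v t)
    (hpos : ∀ t, (Matrix.of fun i j => (v t i j).im).PosDef)
    (hinv : ∀ t, IsUnit (c.map Complex.ofReal * v t + d.map Complex.ofReal))
    (p' q' : ℝ → Matrix (Fin 1) (Fin n) ℝ)
    (hp' : ∀ i j, Differentiable ℝ fun t => p' t i j)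
    (hq' : ∀ i j, Differentiable ℝ fun t => q' t i j)
    (p₀ q₀ : Matrix (Fin 1) (Fin n) ℝ) :
    let v₁ : ℝ → Matrix (Fin n) (Fin n) ℂ := fun s =>
      (a.map Complex.ofReal * v s + b.map Complex.ofReal) *
        (c.map Complex.ofReal * v s + d.map Complex.ofReal)⁻¹
    let x : ℝ → Matrix (Fin n) (Fin n) ℝ := fun s => Matrix.of fun i j => (v s i j).re
    let y : ℝ → Matrix (Fin n) (Fin n) ℝ := fun s => Matrix.of fun i j => (v s i j).im
    let x₁ : ℝ → Matrix (Fin n) (Fin n) ℝ := fun s => Matrix.of fun i j => (v₁ s i j).re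
    let y₁ : ℝ → Matrix (Fin n) (Fin n) ℝ := fun s => Matrix.of fun i j => (v₁ s i j).im
    let p₁ : ℝ → Matrix (Fin 1) (Fin n) ℝ := fun s => p₀ + p' s * dᵀ - q' s * cᵀ
    let q₁ : ℝ → Matrix (Fin 1) (Fin n) ℝ := fun s => q₀ - p' s * bᵀ + q' s * aᵀ
    ∀ t : ℝ,
      let dp' : Matrix (Fin 1) (Fin n) ℝ :=
        Matrix.of fun i j => deriv (fun s => p' s i j) t
      let dq' : Matrix (Fin 1) (Fin n) ℝ :=
        Matrix.of fun i j => deriv (fun s => q' s i j) t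
      let dp₁ : Matrix (Fin 1) (Fin n) ℝ :=
        Matrix.of fun i j => deriv (fun s => p₁ s i j) t
      let dq₁ : Matrix (Fin 1) (Fin n) ℝ :=
        Matrix.of fun i j => deriv (fun s => q₁ s i j) t
      (dp₁ * (y₁ t + x₁ t * (y₁ t)⁻¹ * x₁ t) * dp₁ᵀ + dq₁ * (y₁ t)⁻¹ * dq₁ᵀ +
          (2 : ℝ) • (dp₁ * (x₁ t * (y₁ t)⁻¹) * dq₁ᵀ)) 0 0 =
        (dp' * (y t + x t * (y t)⁻¹ * x t) * dp'ᵀ + dq' * (y t)⁻¹ * dq'ᵀ +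
          (2 : ℝ) • (dp' * (x t * (y t)⁻¹) * dq'ᵀ)) 0 0 := by
  intro v₁ x y x₁ y₁ p₁ q₁ t dp' dq' dp₁ dq₁
  have hdp : dp₁ = dp' * dᵀ - dq' * cᵀ := by
    ext i j
    have : HasDerivAt (fun s => p₁ s i j) ((dp' * dᵀ - dq' * cᵀ) i j) t := by
      have h := ((HasDerivAt.fun_sum (u := Finset.univ) fun k _ => ((hp' i k t).hasDerivAt.mul_const (dᵀ k j))).const_add (p₀ i j)).sub
        (HasDerivAt.fun_sum (u := Finset.univ) fun k _ => ((hq' i k t).hasDerivAt.mul_const (cᵀ k j)))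
      exact h
    exact this.deriv
  have hdq : dq₁ = - (dp' * bᵀ) + dq' * aᵀ := by
    ext i j
    have : HasDerivAt (fun s => q₁ s i j) ((- (dp' * bᵀ) + dq' * aᵀ) i j) t := by
      have h := ((HasDerivAt.fun_sum (u := Finset.univ) fun k _ => ((hp' i k t).hasDerivAt.mul_const (bᵀ k j))).const_sub (q₀ i j)).add
        (HasDerivAt.fun_sum (u := Finset.univ) fun k _ => ((hq' i k t).hasDerivAt.mul_const (aᵀ k j)))
      exact h
    exact this.deriv
  clear_value dp₁ dq₁ dp' dq'
  subst hdp hdq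
  rw [Matrix.fromBlocks_transpose, Matrix.fromBlocks_multiply, Matrix.fromBlocks_multiply] at hM
  obtain ⟨h1, h3, h4, h2⟩ := Matrix.fromBlocks_inj.1 hM
  simp only [Matrix.mul_zero, Matrix.mul_one, Matrix.mul_neg, zero_add, add_zero, Matrix.neg_mul] at h1 h2 h3 h4
  have mm : ∀ {k l m : ℕ} (A : Matrix (Fin k) (Fin l) ℝ) (B : Matrix (Fin l) (Fin m) ℝ),
     (A * B).map Complex.ofReal = A.map Complex.ofReal * B.map Complex.ofReal := by
    intro k l m A B; ext i j; simp [Matrix.mul_apply]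
  have ms : ∀ {k l : ℕ} (A B : Matrix (Fin k) (Fin l) ℝ),
     (A - B).map Complex.ofReal = A.map Complex.ofReal - B.map Complex.ofReal := by
    intro k l A B; ext i j; simp
  have ma : ∀ {k l : ℕ} (A B : Matrix (Fin k) (Fin l) ℝ),
     (-A + B).map Complex.ofReal = -A.map Complex.ofReal + B.map Complex.ofReal := by
    intro k l A B; ext i j; simp
  have m1 : (1 : Matrix (Fin n) (Fin n) ℝ).map Complex.ofReal = 1 := by
    ext i j; simp [Matrix.one_apply, apply_ite]
  have g1 : aᵀ * c = cᵀ * a := by linear_combination (norm := noncomm_ring) h1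
  have g2 : bᵀ * d = dᵀ * b := by linear_combination (norm := noncomm_ring) h2
  have g3 : aᵀ * d - cᵀ * b = 1 := by linear_combination (norm := noncomm_ring) h3
  have g4 : dᵀ * a - bᵀ * c = 1 := by linear_combination (norm := noncomm_ring) -h4
  replace g1 := congrArg (fun m => m.map Complex.ofReal) g1
  replace g2 := congrArg (fun m => m.map Complex.ofReal) g2
  replace g3 := congrArg (fun m => m.map Complex.ofReal) g3
  replace g4 := congrArg (fun m => m.map Complex.ofReal) g4
  simp only [ms, mm, m1] at g1 g2 g3 g4
  have key := fun u w => jac_aux_ring _ _ _ _ _ _ _ _ u w g1 g2 g3 g4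
  set A := a.map Complex.ofReal with hA
  set B := b.map Complex.ofReal with hB
  set C := c.map Complex.ofReal with hC
  set D := d.map Complex.ofReal with hD
  have at' : aᵀ.map Complex.ofReal = Aᵀ := rfl
  have bt' : bᵀ.map Complex.ofReal = Bᵀ := rfl
  have ct' : cᵀ.map Complex.ofReal = Cᵀ := rfl
  have dt' : dᵀ.map Complex.ofReal = Dᵀ := rfl
  have ah' : Aᴴ = Aᵀ := by ext i j; simp [A]
  have bh' : Bᴴ = Bᵀ := by ext i j; simp [B]
  have ch' : Cᴴ = Cᵀ := by ext i j; simp [C]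
  have dh' : Dᴴ = Dᵀ := by ext i j; simp [D]
  simp only [at', bt', ct', dt'] at g1 g2 g3 g4 key
  obtain ⟨N, hN⟩ : ∃ N, N = C * v t + D := ⟨_, rfl⟩
  have hNu : IsUnit N := hN ▸ hinv t
  have hNd : IsUnit N.det := (Matrix.isUnit_iff_isUnit_det N).1 hNu
  have hv1 : v₁ t = (A * v t + B) * N⁻¹ := by rw [hN]
  have hv1N : v₁ t * N = A * v t + B := by
    rw [hv1, Matrix.mul_assoc, Matrix.nonsing_inv_mul N hNd, Matrix.mul_one]
  have hNT : Nᵀ = v t * Cᵀ + Dᵀ := by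
    rw [hN, Matrix.transpose_add, Matrix.transpose_mul, hsymm]
  have hNH : Nᴴ = (v t)ᴴ * Cᵀ + Dᵀ := by
    rw [hN, Matrix.conjTranspose_add, Matrix.conjTranspose_mul, ch', dh']
  have hNHd : IsUnit Nᴴ.det := by rw [Matrix.det_conjTranspose]; exact hNd.star
  have hsym1 : (v₁ t)ᵀ = v₁ t := by
    have e : Nᵀ * (v₁ t - (v₁ t)ᵀ) * N = 0 := by
      have e1 : Nᵀ * (v₁ t - (v₁ t)ᵀ) * N = Nᵀ * (v₁ t * N) - (v₁ t * N)ᵀ * N := by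
        rw [Matrix.transpose_mul (v₁ t) N]; noncomm_ring
      rw [e1, hv1N, hNT, Matrix.transpose_add, Matrix.transpose_mul, hsymm, hN, key, sub_self]
    have hNTu : IsUnit Nᵀ := by rw [Matrix.isUnit_iff_isUnit_det, Matrix.det_transpose]; exact hNd
    have e2 := (hNu.mul_left_eq_zero).1 e
    have e3 := (hNTu.mul_right_eq_zero).1 e2
    exact (sub_eq_zero.1 e3).symm
  have dec : ∀ V : Matrix (Fin n) (Fin n) ℂ, V = (Matrix.of fun i j => (V i j).re).map Complex.ofReal
      + Complex.I • (Matrix.of fun i j => (V i j).im).map Complex.ofReal := by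
    intro V; ext i j; simp [mul_comm Complex.I]
  have dec2 : ∀ V : Matrix (Fin n) (Fin n) ℂ, Vᵀ = V → V - Vᴴ =
      (2 * Complex.I) • (Matrix.of fun i j => (V i j).im).map Complex.ofReal := by
    intro V h; ext i j
    have : V j i = V i j := congrFun (congrFun h i) j
    simp [this]
    apply Complex.ext <;> simp; ring
  have hY : Nᴴ * (y₁ t).map Complex.ofReal * N = (y t).map Complex.ofReal := by
    have e1 : Nᴴ * (v₁ t - (v₁ t)ᴴ) * N = v t - (v t)ᴴ := by
      have e1 : Nᴴ * (v₁ t - (v₁ t)ᴴ) * N = Nᴴ * (v₁ t * N) - (v₁ t * N)ᴴ * N := by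
        rw [Matrix.conjTranspose_mul (v₁ t) N]; noncomm_ring
      rw [e1, hv1N, hNH, Matrix.conjTranspose_add, Matrix.conjTranspose_mul, ah', bh', hN, key]
    rw [dec2 _ hsym1, dec2 _ (hsymm t), Matrix.mul_smul, Matrix.smul_mul] at e1
    exact smul_right_injective _ (by simp : (2 * Complex.I) ≠ 0) e1
  have hyu : IsUnit (y t) := (hpos t).isUnit
  have hdm : ∀ M : Matrix (Fin n) (Fin n) ℝ, (M.map Complex.ofReal).det = (M.det : ℂ) := by
    intro M; exact (RingHom.map_det Complex.ofRealHom M).symm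
  have hYd : IsUnit ((y t).map Complex.ofReal).det := by
    rw [hdm]; exact ((Matrix.isUnit_iff_isUnit_det _).1 hyu).map Complex.ofRealHom
  have hY1d : IsUnit ((y₁ t).map Complex.ofReal).det := by
    rw [← hY, Matrix.det_mul, Matrix.det_mul] at hYd
    exact isUnit_of_mul_isUnit_right (isUnit_of_mul_isUnit_left hYd)
  have hy1u : IsUnit (y₁ t) := by
    rw [Matrix.isUnit_iff_isUnit_det, isUnit_iff_ne_zero]
    rw [hdm, isUnit_iff_ne_zero] at hY1d
    exact_mod_cast hY1d
  have reT : ∀ V : Matrix (Fin n) (Fin n) ℂ, Vᵀ = V → (Matrix.of fun i j => (V i j).re)ᵀ = (Matrix.of fun i j => (V i j).re) := by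
    intro V h; ext i j
    exact congrArg Complex.re (congrFun (congrFun h i) j)
  have imT : ∀ V : Matrix (Fin n) (Fin n) ℂ, Vᵀ = V → (Matrix.of fun i j => (V i j).im)ᵀ = (Matrix.of fun i j => (V i j).im) := by
    intro V h; ext i j
    exact congrArg Complex.im (congrFun (congrFun h i) j)
  apply Complex.ofReal_injective
  rw [jac_form (v t) (x t) (y t) (reT _ (hsymm t)) (imT _ (hsymm t)) hyu (dec _),
    jac_form (v₁ t) (x₁ t) (y₁ t) (reT _ hsym1) (imT _ hsym1) hy1u (dec _)]
  rw [ms, ma, mm, mm, mm, mm, at', bt', ct', dt']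
  generalize dp'.map Complex.ofReal = P
  generalize dq'.map Complex.ofReal = Q
  obtain ⟨W, hW⟩ : ∃ W, W = (P * Dᵀ - Q * Cᵀ) * v₁ t + (-(P * Bᵀ) + Q * Aᵀ) := ⟨_, rfl⟩
  have hWN : P * v t + Q = W * N := by
    have e : W * N = P * (Dᵀ * (v₁ t * N) - Bᵀ * N) - Q * (Cᵀ * (v₁ t * N) - Aᵀ * N) := by
      rw [hW]
      simp only [Matrix.add_mul, Matrix.sub_mul, Matrix.mul_sub, Matrix.neg_mul, Matrix.mul_assoc]
      abel
    have k0 : Dᵀ * (A * v t + B) - Bᵀ * N = v t := by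
      have := key (v t) 0
      simpa [hN] using this
    have k1 : Cᵀ * (A * v t + B) - Aᵀ * N = -1 := by
      rw [hN]
      linear_combination (norm := noncomm_ring) -g1 * v t - g3
    rw [e, hv1N, k0, k1]; simp
  rw [← hW, hWN, ← hY, Matrix.mul_inv_rev, Matrix.mul_inv_rev, Matrix.conjTranspose_mul]
  congr 1
  simp only [Matrix.mul_assoc]
  rw [← Matrix.mul_assoc N N⁻¹, Matrix.mul_nonsing_inv N hNd, Matrix.one_mul,
    ← Matrix.mul_assoc (Nᴴ)⁻¹, Matrix.nonsing_inv_mul _ hNHd, Matrix.one_mul]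
end
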